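/- The cone of 3×3 real symmetric positive semidefinite matrices does not admit a second-order cone lift: there is no finite k, linear subspace L ⊆ ℝ^{3k}, and linear map π : ℝ^{3k} → 𝕊³ such that 𝕊³₊ = π(Q^k ∩ L). -/

import Mathlib

/-- The three-dimensional second-order cone. -/
def soc (v : Fin 3 → ℝ) : Prop := Real.sqrt (v 0 ^ 2 + v 1 ^ 2) ≤ v 2

/-- The cartesian product of `k` copies of the second-order cone, as a subset of
`ℝ^{3k}`. -/
def socProd (k : ℕ) : Set (Fin k → Fin 3 → ℝ) := {y | ∀ l, soc (y l)}

open Filter Topology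

lemma soc_iff {v : Fin 3 → ℝ} : soc v ↔ 0 ≤ v 2 ∧ v 0 ^ 2 + v 1 ^ 2 ≤ v 2 ^ 2 := by
  rw [soc, Real.sqrt_le_iff]

lemma soc.add {v w : Fin 3 → ℝ} (hv : soc v) (hw : soc w) : soc (v + w) := by
  rw [soc_iff] at *
  obtain ⟨hv0, hv⟩ := hv
  obtain ⟨hw0, hw⟩ := hw
  refine ⟨add_nonneg hv0 hw0, ?_⟩
  have h : v 0 * w 0 + v 1 * w 1 ≤ v 2 * w 2 := by
    refine abs_le_of_sq_le_sq' ?_ (mul_nonneg hv0 hw0) |>.2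
    have := mul_le_mul hv hw (by positivity) (by positivity)
    nlinarith [sq_nonneg (v 0 * w 1 - v 1 * w 0)]
  simp only [Pi.add_apply]
  nlinarith

lemma soc.smul {v : Fin 3 → ℝ} (hv : soc v) {c : ℝ} (hc : 0 ≤ c) : soc (c • v) := by
  rw [soc_iff] at *
  simp only [Pi.smul_apply, smul_eq_mul]
  exact ⟨mul_nonneg hc hv.1, by nlinarith [mul_le_mul_of_nonneg_left hv.2 (sq_nonneg c)]⟩

lemma eventually_soc_sub_smul_of_lt {v : Fin 3 → ℝ} (hv : √(v 0 ^ 2 + v 1 ^ 2) < v 2)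
    (w : Fin 3 → ℝ) : ∀ᶠ ε : ℝ in 𝓝[>] 0, soc (v - ε • w) := by
  apply Filter.Eventually.filter_mono nhdsWithin_le_nhds
  have h : ∀ᶠ ε : ℝ in 𝓝 0, √((v 0 - ε * w 0) ^ 2 + (v 1 - ε * w 1) ^ 2) < v 2 - ε * w 2 := by
    apply ContinuousAt.eventually_lt
    · fun_prop
    · fun_prop
    · simpa using hv
  filter_upwards [h] with ε hε
  exact hε.le

lemma eventually_soc_add_sub_smul_smul {v w : Fin 3 → ℝ} (hv : soc v) (hw : soc w) (r : ℝ) :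
    ∀ᶠ ε : ℝ in 𝓝[>] 0, soc (v + w - ε • r • v) := by
  apply Filter.Eventually.filter_mono nhdsWithin_le_nhds
  have h : ∀ᶠ ε : ℝ in 𝓝 0, ε * r < 1 := by
    apply ContinuousAt.eventually_lt
    · fun_prop
    · fun_prop
    · simp
  filter_upwards [h] with ε hε
  have : v + w - ε • r • v = (1 - ε * r) • v + w := by module
  rw [this]
  exact (hv.smul (by linarith)).add hw

lemma soc.sqrt_add_lt {v w : Fin 3 → ℝ} (hv : soc v) (hw : soc w) (hv0 : 0 < v 2)
    (hw0 : 0 < w 2) (h : (v 0 / v 2, v 1 / v 2) ≠ (w 0 / w 2, w 1 / w 2)) :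
    √((v + w) 0 ^ 2 + (v + w) 1 ^ 2) < (v + w) 2 := by
  rw [soc_iff] at hv hw
  have key : v 0 * w 0 + v 1 * w 1 < v 2 * w 2 := by
    have hpos : 0 < (v 0 * w 2 - w 0 * v 2) ^ 2 + (v 1 * w 2 - w 1 * v 2) ^ 2 := by
      by_contra hn
      apply h
      rw [Prod.mk.injEq, div_eq_div_iff hv0.ne' hw0.ne', div_eq_div_iff hv0.ne' hw0.ne']
      constructor <;> nlinarith [sq_nonneg (v 0 * w 2 - w 0 * v 2),
        sq_nonneg (v 1 * w 2 - w 1 * v 2)]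
    have h1 := mul_le_mul_of_nonneg_right hv.2 (sq_nonneg (w 2))
    have h2 := mul_le_mul_of_nonneg_right hw.2 (sq_nonneg (v 2))
    have h3 : (v 2 * w 2) * (v 0 * w 0 + v 1 * w 1) < (v 2 * w 2) * (v 2 * w 2) := by nlinarith
    exact lt_of_mul_lt_mul_left h3 (by positivity)
  rw [Real.sqrt_lt' (by simpa using add_pos hv0 hw0)]
  simp only [Pi.add_apply]
  nlinarith [hv.2, hw.2]

/-- Every sequence in the second-order cone has an infinite subfamily in which the minimal face
containing any two members contains all other members. -/
lemma exists_infinite_eventually_soc {z : ℕ → Fin 3 → ℝ} (hz : ∀ n, soc (z n)) {S : Set ℕ}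
    (hS : S.Infinite) :
    ∃ T ⊆ S, T.Infinite ∧ ∀ s ∈ T, ∀ t ∈ T, s ≠ t → ∀ u ∈ T,
      ∀ᶠ ε : ℝ in 𝓝[>] 0, soc (z s + z t - ε • z u) := by
  by_cases h0 : {n ∈ S | z n 2 = 0}.Infinite
  · refine ⟨_, Set.sep_subset _ _, h0, fun s _ t _ _ u hu => ?_⟩
    have hu0 : z u = 0 := by
      have h := (soc_iff.1 (hz u)).2
      rw [hu.2] at h
      ext i
      fin_cases i
      · simp; nlinarith [sq_nonneg (z u 0), sq_nonneg (z u 1)]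
      · simp; nlinarith [sq_nonneg (z u 0), sq_nonneg (z u 1)]
      · exact hu.2
    simp [hu0, (hz s).add (hz t)]
  set S' := S \ {n ∈ S | z n 2 = 0}
  have hS'inf : S'.Infinite := hS.sdiff (Set.not_infinite.1 h0)
  have hpos : ∀ n ∈ S', 0 < z n 2 := fun n hn =>
    lt_of_le_of_ne (soc_iff.1 (hz n)).1 fun h => hn.2 ⟨hn.1, h.symm⟩
  let f : ℕ → ℝ × ℝ := fun n => (z n 0 / z n 2, z n 1 / z n 2)
  by_cases hf : (f '' S').Infinite
  · obtain ⟨T, hTS, hT⟩ := (Set.surjOn_image f S').exists_bijOn_subset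
    refine ⟨T, hTS.trans Set.sdiff_subset, Set.Infinite.of_image f (hT.image_eq ▸ hf),
      fun s hs t ht hst u _ => eventually_soc_sub_smul_of_lt ?_ _⟩
    exact (hz s).sqrt_add_lt (hz t) (hpos s (hTS hs)) (hpos t (hTS ht))
      fun h => hst (hT.injOn hs ht h)
  · obtain ⟨c, hc⟩ : ∃ c, {n ∈ S' | f n = c}.Infinite := by
      by_contra! hfin
      exact hS'inf (Set.Finite.of_finite_fibers f (Set.not_infinite.1 hf) fun c _ => hfin c)
    refine ⟨_, (Set.sep_subset _ _).trans Set.sdiff_subset, hc, fun s hs t _ _ u hu => ?_⟩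
    have hs0 := hpos s hs.1
    have hu0 := hpos u hu.1
    have hfu : f u = f s := hu.2.trans hs.2.symm
    simp only [f, Prod.mk.injEq] at hfu
    rw [div_eq_div_iff hu0.ne' hs0.ne', div_eq_div_iff hu0.ne' hs0.ne'] at hfu
    have hzu : z u = (z u 2 / z s 2) • z s := by
      ext i
      fin_cases i <;> simp <;> field_simp <;> linarith
    rw [hzu]
    exact eventually_soc_add_sub_smul_smul (hz s) (hz t) _

lemma exists_infinite_forall_eventually_soc {ι : Type*} (F : Finset ι) {z : ℕ → ι → Fin 3 → ℝ}
    (hz : ∀ n i, soc (z n i)) :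
    ∃ T : Set ℕ, T.Infinite ∧ ∀ i ∈ F, ∀ s ∈ T, ∀ t ∈ T, s ≠ t → ∀ u ∈ T,
      ∀ᶠ ε : ℝ in 𝓝[>] 0, soc (z s i + z t i - ε • z u i) := by
  classical
  induction F using Finset.induction_on with
  | empty => exact ⟨Set.univ, Set.infinite_univ, by simp⟩
  | insert i F _ ih =>
    obtain ⟨S, hS, hSF⟩ := ih
    obtain ⟨T, hTS, hT, hTi⟩ := exists_infinite_eventually_soc (z := fun n => z n i)
      (fun n => hz n i) hS
    refine ⟨T, hT, fun j hj s hs t ht hst u hu => ?_⟩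
    rcases Finset.mem_insert.1 hj with rfl | hj
    · exact hTi s hs t ht hst u hu
    · exact hSF j hj s (hTS hs) t (hTS ht) hst u (hTS hu)

/-- The rank-one matrix of the vector `(1, t, t²)`. -/
def momentMatrix (t : ℝ) : Matrix (Fin 3) (Fin 3) ℝ :=
  Matrix.vecMulVec ![1, t, t ^ 2] ![1, t, t ^ 2]

lemma momentMatrix_posSemidef (t : ℝ) : (momentMatrix t).PosSemidef := by
  simpa [momentMatrix] using Matrix.posSemidef_vecMulVec_self_star (![1, t, t ^ 2] : Fin 3 → ℝ)

lemma not_posSemidef_momentMatrix_sub {s t u ε : ℝ} (hs : u ≠ s) (ht : u ≠ t) (hε : 0 < ε) :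
    ¬ (momentMatrix s + momentMatrix t - ε • momentMatrix u).PosSemidef := by
  intro h
  have hq := h.dotProduct_mulVec_nonneg ![s * t, -(s + t), 1]
  have hval : star ![s * t, -(s + t), 1] ⬝ᵥ
      (momentMatrix s + momentMatrix t - ε • momentMatrix u).mulVec ![s * t, -(s + t), 1] =
      -(ε * ((u - s) * (u - t)) ^ 2) := by
    simp [momentMatrix, Matrix.vecMulVec, Matrix.mulVec, dotProduct, Fin.sum_univ_three]
    ring
  rw [hval] at hq
  have : (u - s) * (u - t) ≠ 0 := mul_ne_zero (sub_ne_zero.2 hs) (sub_ne_zero.2 ht)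
  have : 0 < ε * ((u - s) * (u - t)) ^ 2 := by positivity
  linarith

theorem psd3_no_soc_lift :
    ¬ ∃ (k : ℕ) (L : Submodule ℝ (Fin k → Fin 3 → ℝ))
      (π : (Fin k → Fin 3 → ℝ) →ₗ[ℝ] Matrix (Fin 3) (Fin 3) ℝ),
      {X : Matrix (Fin 3) (Fin 3) ℝ | X.PosSemidef} =
        π '' (socProd k ∩ (L : Set (Fin k → Fin 3 → ℝ))) := by
  rintro ⟨k, L, π, h⟩
  have hlift : ∀ n : ℕ, ∃ z ∈ socProd k ∩ (L : Set (Fin k → Fin 3 → ℝ)),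
      π z = momentMatrix n := fun n =>
    h.subset (momentMatrix_posSemidef n)
  choose z hz hπ using hlift
  obtain ⟨T, hT, hTz⟩ := exists_infinite_forall_eventually_soc Finset.univ fun n => (hz n).1
  obtain ⟨s, hs⟩ := hT.nonempty
  obtain ⟨t, ht, hst⟩ := hT.exists_gt s
  obtain ⟨u, hu, htu⟩ := hT.exists_gt t
  have hev : ∀ᶠ ε : ℝ in 𝓝[>] 0, ∀ i, soc (z s i + z t i - ε • z u i) :=
    eventually_all.2 fun i => hTz i (Finset.mem_univ i) s hs t ht hst.ne u hu
  obtain ⟨ε, hε, hε0⟩ := (hev.and self_mem_nhdsWithin).exists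
  have hmem : π (z s + z t - ε • z u) ∈ {X : Matrix (Fin 3) (Fin 3) ℝ | X.PosSemidef} := by
    rw [h]
    exact ⟨_, ⟨hε, L.sub_mem (L.add_mem (hz s).2 (hz t).2) (L.smul_mem ε (hz u).2)⟩, rfl⟩
  rw [map_sub, map_add, map_smul, hπ, hπ, hπ] at hmem
  exact not_posSemidef_momentMatrix_sub (by exact_mod_cast (hst.trans htu).ne')
    (by exact_mod_cast htu.ne') hε0 hmem
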